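/- Let m ≥ 1 and j ≥ 0 be integers and ν = m + j. Then for x > 0, K_ν(x) = (1/2) ∑_{n=0}^{ν-1} (-1)^n ((ν-n-1)!/n!) (x/2)^{2n-ν} + (-1)^{ν+1} ∑_{n=0}^{∞} (1/(n!(ν+n)!)) (x/2)^{2n+ν} (ln(x/2) - (1/2)ψ(n+1) - (1/2)ψ(ν+n+1)). -/

import Mathlib

open Real Filter

noncomputable section

/-- Modified Bessel function of the first kind,
    I_ν(x) = ∑ₙ (x/2)^{ν+2n}/(n! Γ(ν+n+1)). -/
def besselI (ν x : ℝ) : ℝ :=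
  ∑' n : ℕ, (x / 2) ^ (ν + 2 * (n : ℝ)) / ((Nat.factorial n : ℝ) * Real.Gamma (ν + n + 1))

/-- Modified Bessel function of the second kind:
    K_ν(x) = (π/(2 sin(νπ)))(I₋ν(x) - I_ν(x)) for non-integer ν,
    extended by continuity (limit over non-integer orders) to integer ν. -/
def besselK (ν x : ℝ) : ℝ :=
  limUnder (nhdsWithin ν {μ : ℝ | ∀ n : ℤ, μ ≠ (n : ℝ)})
    (fun μ => Real.pi / (2 * Real.sin (μ * Real.pi)) * (besselI (-μ) x - besselI μ x))

/-- Digamma function ψ(z) = (ln Γ(z))'. -/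
def digammaR (z : ℝ) : ℝ := deriv (fun t : ℝ => Real.log (Real.Gamma t)) z


lemma invGamma_bound : ∃ C : ℝ, 0 ≤ C ∧ ∀ k : ℕ, ∀ w ∈ Metric.ball (0:ℂ) (1/2),
    ‖(Complex.Gamma ((k:ℂ) + 1 + w))⁻¹‖ ≤ C * 2 ^ k := by
  have hc : Continuous (fun w : ℂ => (Complex.Gamma (1 + w))⁻¹) :=
    (Complex.differentiable_one_div_Gamma.continuous).comp (by fun_prop : Continuous fun w : ℂ => 1 + w)
  obtain ⟨C, hC⟩ := (isCompact_closedBall (0:ℂ) (1/2)).exists_bound_of_continuousOn hc.continuousOn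
  refine ⟨C, (norm_nonneg _).trans (hC 0 (by simp)), fun k w hw => ?_⟩
  induction k with
  | zero => simpa using hC w (Metric.ball_subset_closedBall hw)
  | succ k ih =>
    have hw' : ‖w‖ < 1/2 := by simpa using hw
    have h1 : (1/2 : ℝ) ≤ ‖(k:ℂ) + 1 + w‖ := by
      have h := norm_sub_norm_le ((k:ℂ) + 1) (-w)
      rw [sub_neg_eq_add, norm_neg] at h
      have h2 : ‖(k:ℂ) + 1‖ = k + 1 := by
        have := Complex.norm_natCast (k+1)
        push_cast at this; exact this
      have : (0:ℝ) ≤ k := Nat.cast_nonneg k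
      linarith
    have h0 : (k:ℂ) + 1 + w ≠ 0 := by
      intro h; rw [h] at h1; norm_num at h1
    have e : ((k+1 : ℕ) : ℂ) + 1 + w = ((k:ℂ) + 1 + w) + 1 := by push_cast; ring
    rw [e, Complex.Gamma_add_one _ h0, mul_inv, norm_mul, norm_inv, pow_succ]
    have h3 : ‖(k:ℂ) + 1 + w‖⁻¹ ≤ 2 := by
      rw [inv_le_comm₀ (by linarith) (by norm_num)]; linarith
    calc _ ≤ 2 * (C * 2 ^ k) := mul_le_mul h3 ih (norm_nonneg _) (by norm_num)
      _ = _ := by ring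

/-- complex terms -/
def Ft (q : ℝ) (a b k : ℕ) (w : ℂ) : ℂ :=
  ((q ^ k / (Nat.factorial (b + k) : ℝ) : ℝ) : ℂ) * (Complex.Gamma (((a + k : ℕ) : ℂ) + 1 + w))⁻¹

/-- real terms -/
def Fr (q : ℝ) (a b k : ℕ) (t : ℝ) : ℝ :=
  (q ^ k / (Nat.factorial (b + k) : ℝ)) * (Real.Gamma (((a + k : ℕ) : ℝ) + 1 + t))⁻¹

lemma Ft_ofReal (q : ℝ) (a b k : ℕ) (t : ℝ) : Ft q a b k (t:ℂ) = ((Fr q a b k t : ℝ) : ℂ) := by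
  unfold Ft Fr
  have : (((a + k : ℕ) : ℂ) + 1 + (t:ℂ)) = (((((a + k : ℕ) : ℝ) + 1 + t : ℝ)) : ℂ) := by push_cast; ring
  rw [this, Complex.Gamma_ofReal]; push_cast; ring

lemma Ft_bound (q : ℝ) (hq : 0 ≤ q) (a b : ℕ) : ∃ u : ℕ → ℝ, Summable u ∧
    ∀ k w, w ∈ Metric.ball (0:ℂ) (1/2) → ‖Ft q a b k w‖ ≤ u k := by
  obtain ⟨C, hC0, hC⟩ := invGamma_bound
  refine ⟨fun k => C * 2 ^ a * ((2 * q) ^ k / (Nat.factorial k : ℝ)),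
    (Real.summable_pow_div_factorial (2 * q)).mul_left _, fun k w hw => ?_⟩
  unfold Ft
  rw [norm_mul, Complex.norm_real, Real.norm_of_nonneg (by positivity)]
  have h1 : q ^ k / (Nat.factorial (b + k) : ℝ) ≤ q ^ k / (Nat.factorial k : ℝ) := by
    gcongr; omega
  calc _ ≤ q ^ k / (Nat.factorial k : ℝ) * (C * 2 ^ (a + k)) :=
        mul_le_mul h1 (hC _ w hw) (norm_nonneg _) (by positivity)
    _ = _ := by simp only [pow_add, mul_pow]; ring

lemma Ft_diff (q : ℝ) (a b k : ℕ) : Differentiable ℂ (Ft q a b k) := by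
  unfold Ft
  exact (Complex.differentiable_one_div_Gamma.comp
    (by fun_prop : Differentiable ℂ fun w : ℂ => ((a + k : ℕ) : ℂ) + 1 + w)).const_mul _

lemma Fr_summable (q : ℝ) (hq : 0 ≤ q) (a b : ℕ) (t : ℝ) (ht : |t| < 1/2) :
    Summable (fun k => Fr q a b k t) := by
  obtain ⟨u, hu, hb⟩ := Ft_bound q hq a b
  refine Summable.of_norm_bounded hu fun k => ?_
  have := hb k (t:ℂ) (by simpa using ht)
  rwa [Ft_ofReal, Complex.norm_real] at this

lemma Fr_hasDerivAt (q : ℝ) (a b k : ℕ) : HasDerivAt (Fr q a b k)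
    (-(q ^ k / ((Nat.factorial (b + k) : ℝ) * (Nat.factorial (a + k) : ℝ))
      * digammaR (((a + k : ℕ) : ℝ) + 1))) 0 := by
  have hpos : (0:ℝ) < ((a + k : ℕ) : ℝ) + 1 := by positivity
  have hG : DifferentiableAt ℝ Real.Gamma (((a + k : ℕ) : ℝ) + 1) :=
    Real.differentiableAt_Gamma fun m => by
      have : (0:ℝ) ≤ m := Nat.cast_nonneg m
      linarith
  have hne : Real.Gamma (((a + k : ℕ) : ℝ) + 1) ≠ 0 := (Real.Gamma_pos_of_pos hpos).ne'
  have hd : digammaR (((a + k : ℕ) : ℝ) + 1)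
      = deriv Real.Gamma (((a + k : ℕ) : ℝ) + 1) / Real.Gamma (((a + k : ℕ) : ℝ) + 1) :=
    (hG.hasDerivAt.log hne).deriv
  have h1 : HasDerivAt (fun t : ℝ => Real.Gamma (((a + k : ℕ) : ℝ) + 1 + t))
      (deriv Real.Gamma (((a + k : ℕ) : ℝ) + 1)) 0 := by
    apply HasDerivAt.comp_const_add
    simpa using hG.hasDerivAt
  have h2 := (h1.inv (by simpa using hne)).const_mul (q ^ k / (Nat.factorial (b + k) : ℝ))
  refine h2.congr_deriv ?_
  rw [hd]
  simp only [add_zero]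
  rw [Real.Gamma_nat_eq_factorial] at *
  field_simp

lemma T_hasDerivAt (q : ℝ) (hq : 0 ≤ q) (a b : ℕ) :
    Summable (fun k : ℕ => q ^ k / ((Nat.factorial (b + k) : ℝ) * (Nat.factorial (a + k) : ℝ))
      * digammaR (((a + k : ℕ) : ℝ) + 1)) ∧
    HasDerivAt (fun t => ∑' k, Fr q a b k t)
    (-∑' k : ℕ, q ^ k / ((Nat.factorial (b + k) : ℝ) * (Nat.factorial (a + k) : ℝ))
      * digammaR (((a + k : ℕ) : ℝ) + 1)) 0 := by
  obtain ⟨u, hu, hb⟩ := Ft_bound q hq a b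
  have h0 : (0:ℂ) ∈ Metric.ball (0:ℂ) (1/2) := by simp
  have hs := Complex.hasSum_deriv_of_summable_norm hu
    (fun k => (Ft_diff q a b k).differentiableOn) Metric.isOpen_ball hb h0
  have hd := (Complex.differentiableOn_tsum_of_summable_norm hu
    (fun k => (Ft_diff q a b k).differentiableOn) Metric.isOpen_ball hb).differentiableAt
    (Metric.isOpen_ball.mem_nhds h0)
  have hk : ∀ k, (deriv (Ft q a b k) 0).re =
    (-(q ^ k / ((Nat.factorial (b + k) : ℝ) * (Nat.factorial (a + k) : ℝ))
      * digammaR (((a + k : ℕ) : ℝ) + 1))) := fun k => by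
    have h1 : HasDerivAt (Ft q a b k) (deriv (Ft q a b k) 0) ((0:ℝ):ℂ) := by
      rw [Complex.ofReal_zero]; exact ((Ft_diff q a b k) 0).hasDerivAt
    have h2 := h1.real_of_complex
    simp only [Ft_ofReal, Complex.ofReal_re] at h2
    exact h2.unique (Fr_hasDerivAt q a b k)
  have hre := Complex.hasSum_re hs
  simp only [hk] at hre
  refine ⟨by simpa using hre.summable.neg, ?_⟩
  have h1 : HasDerivAt (fun w : ℂ => ∑' k, Ft q a b k w)
      (deriv (fun w : ℂ => ∑' k, Ft q a b k w) 0) ((0:ℝ):ℂ) := by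
    rw [Complex.ofReal_zero]; exact hd.hasDerivAt
  have h2 := h1.real_of_complex
  simp only [Ft_ofReal, ← Complex.ofReal_tsum, Complex.ofReal_re] at h2
  rw [← tsum_neg, hre.tsum_eq]
  exact h2

lemma Fr_zero (q : ℝ) (a b k : ℕ) : Fr q a b k 0 =
    q ^ k / ((Nat.factorial (b + k) : ℝ) * (Nat.factorial (a + k) : ℝ)) := by
  unfold Fr
  rw [add_zero, Real.Gamma_nat_eq_factorial]; field_simp

/-- the tail, as a function of the deviation from the integer order -/
def tailF (y : ℝ) (ν : ℕ) (t : ℝ) : ℝ :=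
  y ^ ((ν:ℝ) - t) * (∑' k, Fr (y ^ 2) 0 ν k (-t)) - y ^ ((ν:ℝ) + t) * ∑' k, Fr (y ^ 2) ν 0 k t

lemma besselI_pos_eq (x : ℝ) (hx : 0 < x) (ν : ℕ) (t : ℝ) :
    besselI ((ν:ℝ) + t) x = (x/2) ^ ((ν:ℝ) + t) * ∑' k, Fr ((x/2) ^ 2) ν 0 k t := by
  unfold besselI Fr
  rw [← tsum_mul_left]
  refine tsum_congr fun n => ?_
  have hy : 0 < x/2 := by positivity
  have e1 : (x/2) ^ ((ν:ℝ) + t + 2 * (n:ℝ)) = (x/2) ^ ((ν:ℝ) + t) * ((x/2)^2)^n := by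
    rw [Real.rpow_add hy, ← pow_mul, ← Real.rpow_natCast (x/2) (2*n)]; push_cast; rfl
  have e2 : (ν:ℝ) + t + n + 1 = ((ν + n : ℕ) : ℝ) + 1 + t := by push_cast; ring
  rw [e1, e2, zero_add]
  simp only [div_eq_mul_inv, mul_inv]; ring

lemma besselI_neg_eq (x : ℝ) (hx : 0 < x) (ν : ℕ) (t : ℝ) (ht : |t| < 1/2) :
    besselI (-((ν:ℝ) + t)) x = (∑ n ∈ Finset.range ν, (x / 2) ^ (-((ν:ℝ) + t) + 2 * (n : ℝ)) /
        ((Nat.factorial n : ℝ) * Real.Gamma (-((ν:ℝ) + t) + n + 1)))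
      + (x/2) ^ ((ν:ℝ) - t) * ∑' k, Fr ((x/2) ^ 2) 0 ν k (-t) := by
  have hy : 0 < x/2 := by positivity
  have key : ∀ n : ℕ, (x / 2) ^ (-((ν:ℝ) + t) + 2 * ((n + ν : ℕ) : ℝ)) /
        ((Nat.factorial (n + ν) : ℝ) * Real.Gamma (-((ν:ℝ) + t) + ((n + ν : ℕ) : ℝ) + 1))
        = (x/2) ^ ((ν:ℝ) - t) * Fr ((x/2) ^ 2) 0 ν n (-t) := fun n => by
    unfold Fr
    have e1 : (x/2) ^ (-((ν:ℝ) + t) + 2 * ((n + ν : ℕ) : ℝ)) = (x/2) ^ ((ν:ℝ) - t) * ((x/2)^2)^n := by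
      rw [← pow_mul, ← Real.rpow_natCast (x/2) (2*n), ← Real.rpow_add hy]; congr 1; push_cast; ring
    have e2 : -((ν:ℝ) + t) + ((n + ν : ℕ) : ℝ) + 1 = ((0 + n : ℕ) : ℝ) + 1 + -t := by push_cast; ring
    rw [e1, e2, add_comm n ν]
    simp only [div_eq_mul_inv, mul_inv]; ring
  have hs : Summable (fun n : ℕ => (x / 2) ^ (-((ν:ℝ) + t) + 2 * (n : ℝ)) /
        ((Nat.factorial n : ℝ) * Real.Gamma (-((ν:ℝ) + t) + n + 1))) := by
    rw [← summable_nat_add_iff ν]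
    simp only [key]
    exact (Fr_summable _ (by positivity) 0 ν (-t) (by rwa [abs_neg])).mul_left _
  unfold besselI
  rw [← hs.sum_add_tsum_nat_add ν]
  simp only [key, tsum_mul_left]

lemma tailF_hasDerivAt (y : ℝ) (hy : 0 < y) (ν : ℕ) :
    HasDerivAt (tailF y ν) (-2 * ∑' n : ℕ,
            (1 / ((Nat.factorial n : ℝ) * (Nat.factorial (ν + n) : ℝ)))
              * y ^ (2 * n + ν)
              * (Real.log y - (1/2) * digammaR (n + 1) - (1/2) * digammaR ((ν : ℝ) + n + 1))) 0 := by
  have hq : 0 ≤ y ^ 2 := by positivity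
  obtain ⟨s1, d1⟩ := T_hasDerivAt (y^2) hq 0 ν
  obtain ⟨s2, d2⟩ := T_hasDerivAt (y^2) hq ν 0
  have s0 := Fr_summable (y^2) hq ν 0 0 (by norm_num)
  have z1 : ∀ k, Fr (y^2) 0 ν k 0 = Fr (y^2) ν 0 k 0 := fun k => by
    rw [Fr_zero, Fr_zero, mul_comm]
  have d1' : HasDerivAt (fun t => ∑' k, Fr (y^2) 0 ν k (-t)) _ 0 :=
    HasDerivAt.scomp (g₁ := fun t => ∑' k, Fr (y^2) 0 ν k t) (h := fun t : ℝ => -t)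
      (0:ℝ) (by rw [neg_zero]; exact d1) (hasDerivAt_neg (0:ℝ))
  have p1 : HasDerivAt (fun t : ℝ => y ^ ((ν:ℝ) - t)) _ 0 :=
    ((hasDerivAt_id (0:ℝ)).const_sub (ν:ℝ)).const_rpow hy
  have p2 : HasDerivAt (fun t : ℝ => y ^ ((ν:ℝ) + t)) _ 0 :=
    ((hasDerivAt_id (0:ℝ)).const_add (ν:ℝ)).const_rpow hy
  refine ((p1.mul d1').sub (p2.mul d2)).congr_deriv ?_
  simp only [id, sub_zero, add_zero, neg_zero, z1, Real.rpow_natCast, smul_eq_mul]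
  have hsum : (∑' n : ℕ, (1 / ((Nat.factorial n : ℝ) * (Nat.factorial (ν + n) : ℝ)))
              * y ^ (2 * n + ν)
              * (Real.log y - (1/2) * digammaR (n + 1) - (1/2) * digammaR ((ν : ℝ) + n + 1)))
      = y ^ ν * (Real.log y * (∑' k, Fr (y^2) ν 0 k 0)
        - (1/2) * (∑' k : ℕ, (y^2) ^ k / ((Nat.factorial (ν + k) : ℝ) * (Nat.factorial (0 + k) : ℝ))
      * digammaR (((0 + k : ℕ) : ℝ) + 1))
        - (1/2) * (∑' k : ℕ, (y^2) ^ k / ((Nat.factorial (0 + k) : ℝ) * (Nat.factorial (ν + k) : ℝ))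
      * digammaR (((ν + k : ℕ) : ℝ) + 1))) := by
    rw [← tsum_mul_left, ← tsum_mul_left, ← tsum_mul_left,
      ← (s0.mul_left _).tsum_sub (s1.mul_left _),
      ← ((s0.mul_left _).sub (s1.mul_left _)).tsum_sub (s2.mul_left _), ← tsum_mul_left]
    refine tsum_congr fun k => ?_
    rw [Fr_zero]
    simp only [zero_add, Nat.cast_add]
    rw [pow_add, pow_mul]
    simp only [div_eq_mul_inv, mul_inv]; ring
  rw [hsum]
  ring

lemma tailF_zero (y : ℝ) (ν : ℕ) : tailF y ν 0 = 0 := by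
  unfold tailF
  have z1 : ∀ k, Fr (y^2) 0 ν k 0 = Fr (y^2) ν 0 k 0 := fun k => by
    rw [Fr_zero, Fr_zero, mul_comm]
  simp [z1]

lemma sin_nonint (μ : ℝ) (h : ∀ n : ℤ, μ ≠ (n:ℝ)) : Real.sin (μ * Real.pi) ≠ 0 := by
  intro h0
  obtain ⟨n, hn⟩ := Real.sin_eq_zero_iff.1 h0
  exact h n (mul_right_cancel₀ Real.pi_ne_zero hn).symm

lemma head_term (μ : ℝ) (h : ∀ n : ℤ, μ ≠ (n:ℝ)) (y : ℝ) (n : ℕ) :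
    Real.pi / (2 * Real.sin (μ * Real.pi)) * (y ^ (-μ + 2 * (n : ℝ)) /
        ((Nat.factorial n : ℝ) * Real.Gamma (-μ + n + 1)))
    = (1/2) * ((-1 : ℝ) ^ n * (Real.Gamma (μ - n) / (Nat.factorial n : ℝ)) * y ^ (-μ + 2 * (n : ℝ))) := by
  have hs := sin_nonint μ h
  have hr := Real.Gamma_mul_Gamma_one_sub (μ - n)
  have e : Real.sin (Real.pi * (μ - n)) = (-1)^n * Real.sin (μ * Real.pi) := by
    rw [show Real.pi * (μ - n) = μ * Real.pi - n * Real.pi by ring, Real.sin_sub_nat_mul_pi]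
  have e2 : 1 - (μ - n) = -μ + n + 1 := by ring
  rw [e, e2] at hr
  have hp := Real.pi_ne_zero
  have h1 : ((-1:ℝ)^n) ≠ 0 := by positivity
  have hg : Real.Gamma (-μ + n + 1) ≠ 0 := by
    intro h0
    rw [h0, mul_zero] at hr
    exact (div_ne_zero hp (mul_ne_zero h1 hs)) hr.symm
  have h2 : ((-1:ℝ)^n) * (-1)^n = 1 := by rw [← mul_pow]; simp
  rw [eq_div_iff (mul_ne_zero h1 hs)] at hr
  generalize Real.sin (μ * Real.pi) = s at *
  generalize y ^ (-μ + 2 * (n : ℝ)) = z at *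
  rw [← hr]
  field_simp

lemma nonint_neBot (ν : ℕ) :
    (nhdsWithin (ν:ℝ) {μ : ℝ | ∀ n : ℤ, μ ≠ (n : ℝ)}).NeBot := by
  rw [← mem_closure_iff_nhdsWithin_neBot]
  have : Dense {μ : ℝ | ∀ n : ℤ, μ ≠ (n : ℝ)} := by
    have h := (Set.countable_range (fun n : ℤ => (n:ℝ))).dense_compl ℝ
    refine h.mono ?_
    intro μ hμ n hn
    exact hμ ⟨n, hn.symm⟩
  exact this _

theorem stmt17 (m j : ℕ) (hm : 1 ≤ m) (ν : ℕ) (hν : ν = m + j) (x : ℝ) (hx : 0 < x) :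
    besselK (ν : ℝ) x
      = (1/2) * ∑ n ∈ Finset.range ν,
            (-1 : ℝ) ^ n * ((Nat.factorial (ν - n - 1) : ℝ) / (Nat.factorial n : ℝ))
              * (x / 2) ^ (2 * (n : ℤ) - (ν : ℤ))
        + (-1 : ℝ) ^ (ν + 1) * ∑' n : ℕ,
            (1 / ((Nat.factorial n : ℝ) * (Nat.factorial (ν + n) : ℝ)))
              * (x / 2) ^ (2 * n + ν)
              * (Real.log (x / 2) - (1/2) * digammaR (n + 1) - (1/2) * digammaR ((ν : ℝ) + n + 1)) := by
  have hν1 : 1 ≤ ν := by omega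
  have hy : 0 < x / 2 := by positivity
  have := nonint_neBot ν
  unfold besselK
  apply Tendsto.limUnder_eq
  set S : Set ℝ := {μ : ℝ | ∀ n : ℤ, μ ≠ (n : ℝ)} with hS
  set D : ℝ := ∑' n : ℕ,
            (1 / ((Nat.factorial n : ℝ) * (Nat.factorial (ν + n) : ℝ)))
              * (x / 2) ^ (2 * n + ν)
              * (Real.log (x / 2) - (1/2) * digammaR (n + 1) - (1/2) * digammaR ((ν : ℝ) + n + 1)) with hD
  -- the head
  have hhead : Tendsto (fun μ : ℝ => (1/2) * ∑ n ∈ Finset.range ν,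
      ((-1 : ℝ) ^ n * (Real.Gamma (μ - n) / (Nat.factorial n : ℝ)) * (x/2) ^ (-μ + 2 * (n : ℝ))))
      (nhdsWithin (ν:ℝ) S) (nhds ((1/2) * ∑ n ∈ Finset.range ν,
            (-1 : ℝ) ^ n * ((Nat.factorial (ν - n - 1) : ℝ) / (Nat.factorial n : ℝ))
              * (x / 2) ^ (2 * (n : ℤ) - (ν : ℤ)))) := by
    apply tendsto_nhdsWithin_of_tendsto_nhds
    refine Tendsto.const_mul _ (tendsto_finsetSum _ fun n hn => ?_)
    have hn' : n < ν := Finset.mem_range.1 hn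
    have eg : Real.Gamma ((ν:ℝ) - n) = (Nat.factorial (ν - n - 1) : ℝ) := by
      rw [← Real.Gamma_nat_eq_factorial]
      congr 1
      rw [Nat.cast_sub (by omega), Nat.cast_sub (by omega)]; push_cast; ring
    have ep : (x / 2) ^ (2 * (n : ℤ) - (ν : ℤ)) = (x/2) ^ (-(ν:ℝ) + 2 * (n:ℝ)) := by
      rw [← Real.rpow_intCast]; congr 1; push_cast; ring
    rw [← eg, ep]
    have c1 : ContinuousAt Real.Gamma ((ν:ℝ) - n) :=
      (Real.differentiableAt_Gamma fun m => by
        have h1 : (0:ℝ) ≤ m := Nat.cast_nonneg m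
        have h2 : (n:ℝ) < ν := by exact_mod_cast hn'
        linarith).continuousAt
    have c2 : ContinuousAt (fun μ : ℝ => Real.Gamma (μ - n)) (ν:ℝ) :=
      ContinuousAt.comp (f := fun μ : ℝ => μ - n) c1 (by fun_prop)
    have c3 : ContinuousAt (fun μ : ℝ => (x/2) ^ (-μ + 2 * (n:ℝ))) (ν:ℝ) :=
      ContinuousAt.rpow (by fun_prop) (by fun_prop) (Or.inl hy.ne')
    exact ((c2.div_const _).const_mul _).mul c3
  -- the tail
  have hder : HasDerivAt (fun μ : ℝ => tailF (x/2) ν (μ - ν)) (-2 * D) (ν:ℝ) := by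
    apply HasDerivAt.comp_sub_const
    rw [sub_self]; exact tailF_hasDerivAt (x/2) hy ν
  have hsin : HasDerivAt (fun μ : ℝ => Real.sin (μ * Real.pi)) ((-1)^ν * Real.pi) (ν:ℝ) := by
    have := ((hasDerivAt_id (ν:ℝ)).mul_const Real.pi).sin
    simpa [Real.cos_nat_mul_pi] using this
  have hle : nhdsWithin (ν:ℝ) S ≤ nhdsWithin (ν:ℝ) {(ν:ℝ)}ᶜ :=
    nhdsWithin_mono _ fun μ hμ h => hμ (ν:ℤ) (by simpa using h)
  have hsg : ((-1:ℝ)^ν) ≠ 0 := by positivity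
  have htail : Tendsto (fun μ : ℝ => Real.pi / (2 * Real.sin (μ * Real.pi)) * tailF (x/2) ν (μ - ν))
      (nhdsWithin (ν:ℝ) S) (nhds ((-1 : ℝ) ^ (ν + 1) * D)) := by
    have h := ((hder.tendsto_slope.mono_left hle).div (hsin.tendsto_slope.mono_left hle)
      (mul_ne_zero hsg Real.pi_ne_zero)).const_mul (Real.pi / 2)
    have e : Real.pi / 2 * (-2 * D / ((-1)^ν * Real.pi)) = (-1 : ℝ) ^ (ν + 1) * D := by
      have h2 : ((-1:ℝ)^ν) * (-1)^ν = 1 := by rw [← mul_pow]; simp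
      have hp := Real.pi_ne_zero
      rw [pow_succ]
      field_simp
      linear_combination (D) * h2
    rw [e] at h
    refine h.congr' ?_
    filter_upwards [self_mem_nhdsWithin] with μ hμ
    have hs := sin_nonint μ hμ
    have hne : μ - ν ≠ 0 := sub_ne_zero.2 (by simpa using hμ (ν:ℤ))
    simp only [Pi.div_apply, slope_def_field, sub_self, tailF_zero, Real.sin_nat_mul_pi, sub_zero]
    field_simp
  refine (hhead.add htail).congr' ?_
  have hnear : ∀ᶠ μ : ℝ in nhdsWithin (ν:ℝ) S, |μ - ν| < 1/2 := by
    apply mem_nhdsWithin_of_mem_nhds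
    have := Metric.ball_mem_nhds (ν:ℝ) (show (0:ℝ) < 1/2 by norm_num)
    simpa [Metric.ball, Real.dist_eq] using this
  filter_upwards [self_mem_nhdsWithin, hnear] with μ hμ hμ2
  have h1 := besselI_pos_eq x hx ν (μ - ν)
  have h2 := besselI_neg_eq x hx ν (μ - ν) hμ2
  rw [add_sub_cancel] at h1 h2
  rw [h1, h2, Finset.mul_sum, Finset.sum_congr rfl fun n _ => (head_term μ hμ (x/2) n).symm,
    ← Finset.mul_sum]
  unfold tailF
  rw [add_sub_cancel]
  ring
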